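/- arXiv:0705.3270 — 2 statements merged into one kernel-verified Lean document; each statement's English description precedes it below -/
import Mathlib

section
/- Let (R,T) = lim (R_n,T_n) be an AF-equivalence relation on a compact, metrizable, zero-dimensional space X, given as the inductive limit of an ascending sequence of CEERs Δ_X = R_0 ⊆ R_1 ⊆ R_2 ⊆ ⋯, and let (S,T̃) be a CEER on X which is transverse to R. Then there exists an ascending sequence of CEERs Δ_X = R'_0 ⊆ R'_1 ⊆ R'_2 ⊆ ⋯ on X such that (R,T) = lim (R'_n,T'_n) and R'_n is transverse to S for every n. -/
open Set Topology MeasureTheory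

universe u v

/-! ### Basic notions: étale equivalence relations -/

/-- The set of composable pairs of an equivalence relation `R ⊆ X × X`. -/
def CompPairs {X : Type u} (R : Set (X × X)) : Set (↥R × ↥R) :=
  {q | (q.1 : X × X).2 = (q.2 : X × X).1}

/-- The topology on the set of composable pairs obtained from a topology `T` on `R`. -/
def compPairsTop {X : Type u} (R : Set (X × X)) (T : TopologicalSpace ↥R) :
    TopologicalSpace ↥(CompPairs R) :=
  letI := T; inferInstance

/-- The composition (product) map of the groupoid `R`. -/
def compMap {X : Type u} (R : Set (X × X))
    (htrans : ∀ ⦃x y z : X⦄, (x, y) ∈ R → (y, z) ∈ R → (x, z) ∈ R) :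
    ↥(CompPairs R) → ↥R := fun q =>
  ⟨((q.1.1 : X × X).1, (q.1.2 : X × X).2),
    htrans q.1.1.2 (by
      rw [show ((q.1.1 : X × X)).2 = ((q.1.2 : X × X)).1 from q.2]
      exact q.1.2.2)⟩

/-- The inverse map of the groupoid `R`. -/
def invMap {X : Type u} (R : Set (X × X))
    (hsymm : ∀ ⦃x y : X⦄, (x, y) ∈ R → (y, x) ∈ R) : ↥R → ↥R := fun p =>
  ⟨((p : X × X).2, (p : X × X).1), hsymm p.2⟩

/-- `(R, T)` is an étale equivalence relation on `X`: a countable equivalence relation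
equipped with a Hausdorff, locally compact, second countable topology `T` such that
composition of composable pairs is continuous, inversion is a homeomorphism, and the
range map `r(x,y) = x` is a local homeomorphism. -/
structure IsEtaleEquivRel {X : Type u} [TopologicalSpace X] (R : Set (X × X))
    (T : TopologicalSpace ↥R) : Prop where
  refl : ∀ x : X, (x, x) ∈ R
  symm : ∀ ⦃x y : X⦄, (x, y) ∈ R → (y, x) ∈ R
  trans : ∀ ⦃x y z : X⦄, (x, y) ∈ R → (y, z) ∈ R → (x, z) ∈ R
  countable : ∀ x : X, {y | (x, y) ∈ R}.Countable
  t2 : @T2Space ↥R T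
  locallyCompact : @LocallyCompactSpace ↥R T
  secondCountable : @SecondCountableTopology ↥R T
  continuous_comp : @Continuous _ _ (compPairsTop R T) T (compMap R trans)
  homeo_inv : @IsHomeomorph _ _ T T (invMap R symm)
  localHomeo_range : @IsLocalHomeomorph ↥R X T inferInstance fun p => (p : X × X).1

/-- A CEER: compact étale equivalence relation. -/
def IsCEER {X : Type u} [TopologicalSpace X] (R : Set (X × X))
    (T : TopologicalSpace ↥R) : Prop :=
  IsEtaleEquivRel R T ∧ @CompactSpace ↥R T

/-- `R ⊆ X × X` is an equivalence relation. -/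
def IsEquivRel {X : Type u} (R : Set (X × X)) : Prop :=
  (∀ x : X, (x, x) ∈ R) ∧ (∀ ⦃x y : X⦄, (x, y) ∈ R → (y, x) ∈ R) ∧
    (∀ ⦃x y z : X⦄, (x, y) ∈ R → (y, z) ∈ R → (x, z) ∈ R)

/-- The relative topology on `R ⊆ X × X` inherited from the product topology. -/
def relTop {X : Type u} [TopologicalSpace X] (R : Set (X × X)) : TopologicalSpace ↥R :=
  inferInstance

/-- Given a topology `T` on `R` and any `U ⊆ X × X` (intended: `U ⊆ R`), the relative
topology on `U` induced from `(R, T)`. -/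
def relSubTop {X : Type u} [TopologicalSpace X] {R : Set (X × X)}
    (T : TopologicalSpace ↥R) (U : Set (X × X)) : TopologicalSpace ↥U :=
  TopologicalSpace.induced Subtype.val
    (TopologicalSpace.coinduced (Subtype.val : ↥R → X × X) T)

/-- An equivalence relation is minimal if all equivalence classes are dense. -/
def IsMinimalRel {X : Type u} [TopologicalSpace X] (R : Set (X × X)) : Prop :=
  ∀ x : X, Dense {y | (x, y) ∈ R}

/-- `F` implements an isomorphism between the étale equivalence relations
`(R₁, T₁)` on `X` and `(R₂, T₂)` on `Z`. -/
def ImplementsIso {X : Type u} {Z : Type v} [TopologicalSpace X] [TopologicalSpace Z]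
    (R₁ : Set (X × X)) (T₁ : TopologicalSpace ↥R₁)
    (R₂ : Set (Z × Z)) (T₂ : TopologicalSpace ↥R₂) (F : X → Z) : Prop :=
  IsHomeomorph F ∧ (∀ x y : X, (x, y) ∈ R₁ ↔ (F x, F y) ∈ R₂) ∧
    ∃ G : ↥R₁ → ↥R₂, (∀ p : ↥R₁, (G p : Z × Z) = (F (p : X × X).1, F (p : X × X).2)) ∧
      @IsHomeomorph _ _ T₁ T₂ G

/-! ### Graphs, invariant measures, thin sets -/

/-- A (local) graph in `(R, T)`: a clopen subset on which both the range and source maps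
are homeomorphisms onto clopen subsets of `X`. -/
def IsGraph {X : Type u} [TopologicalSpace X] (R : Set (X × X))
    (T : TopologicalSpace ↥R) (U : Set ↥R) : Prop :=
  letI := T
  IsClopen U ∧
    IsClopen ((fun p : ↥R => (p : X × X).1) '' U) ∧
    IsClopen ((fun p : ↥R => (p : X × X).2) '' U) ∧
    Topology.IsEmbedding (fun p : ↥U => ((p : ↥R) : X × X).1) ∧
    Topology.IsEmbedding (fun p : ↥U => ((p : ↥R) : X × X).2)

/-- A probability measure is `R`-invariant when `μ(A) = μ(B)` for every graph `(A, γ, B)`. -/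
def IsInvariantMeasure {X : Type u} [TopologicalSpace X] [MeasurableSpace X]
    (R : Set (X × X)) (T : TopologicalSpace ↥R) (μ : Measure X) : Prop :=
  ∀ U : Set ↥R, IsGraph R T U →
    μ ((fun p : ↥R => (p : X × X).1) '' U) = μ ((fun p : ↥R => (p : X × X).2) '' U)

/-- `Y` is `R`-thin: `μ Y = 0` for every `R`-invariant probability measure `μ`. -/
def IsThin {X : Type u} [TopologicalSpace X] [MeasurableSpace X]
    (R : Set (X × X)) (T : TopologicalSpace ↥R) (Y : Set X) : Prop :=
  ∀ μ : Measure X, IsProbabilityMeasure μ → IsInvariantMeasure R T μ → μ Y = 0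

/-! ### AF-equivalence relations -/

/-- The inductive limit topology on `R = ⋃ n, Rseq n`, each `Rseq n` carrying its
relative topology from `X × X`. -/
def inductiveLimitTop {X : Type u} [TopologicalSpace X] (R : Set (X × X))
    (Rseq : ℕ → Set (X × X)) (hsub : ∀ n, Rseq n ⊆ R) : TopologicalSpace ↥R :=
  ⨆ n, TopologicalSpace.coinduced
    (fun p : ↥(Rseq n) => (⟨(p : X × X), hsub n p.2⟩ : ↥R)) (relTop (Rseq n))

/-- `(R, T)` is an AF-equivalence relation: the inductive limit of an ascending sequence
of CEERs `Δ_X = R₀ ⊆ R₁ ⊆ R₂ ⊆ ⋯` with each `Rₙ` open in `Rₙ₊₁`, `T` being the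
inductive limit topology. -/
def IsAFEquivRel {X : Type u} [TopologicalSpace X] (R : Set (X × X))
    (T : TopologicalSpace ↥R) : Prop :=
  ∃ (Rseq : ℕ → Set (X × X)) (hsub : ∀ n, Rseq n ⊆ R),
    Rseq 0 = Set.diagonal X ∧
    (∀ n, Rseq n ⊆ Rseq (n + 1)) ∧
    (∀ n, IsCEER (Rseq n) (relTop (Rseq n))) ∧
    (∀ n, IsOpen[relTop (Rseq (n + 1))]
      ((Subtype.val : ↥(Rseq (n + 1)) → X × X) ⁻¹' Rseq n)) ∧
    (⋃ n, Rseq n) = R ∧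
    T = inductiveLimitTop R Rseq hsub

/-! ### Clopen partitions and groupoid partitions -/

/-- `U · V` for subsets `U, V ⊆ X × X`. -/
def SetComp {X : Type u} (U V : Set (X × X)) : Set (X × X) :=
  {p | ∃ y : X, (p.1, y) ∈ U ∧ (y, p.2) ∈ V}

/-- `U⁻¹` for a subset `U ⊆ X × X`. -/
def SetInv {X : Type u} (U : Set (X × X)) : Set (X × X) :=
  {p | (p.2, p.1) ∈ U}

/-- `P` is finer than `Q` if every element of `P` is contained in some element of `Q`. -/
def FinerThan {α : Type u} (P Q : Set (Set α)) : Prop :=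
  ∀ U ∈ P, ∃ V ∈ Q, U ⊆ V

/-- A finite clopen partition of `(R, T)` by subsets of `X × X`. -/
def IsClopenPartitionRel {X : Type u} [TopologicalSpace X] (R : Set (X × X))
    (T : TopologicalSpace ↥R) (P : Set (Set (X × X))) : Prop :=
  letI := T
  P.Finite ∧ (∀ U ∈ P, U ⊆ R ∧ U.Nonempty ∧ IsClopen ((Subtype.val : ↥R → X × X) ⁻¹' U)) ∧
    P.PairwiseDisjoint id ∧ ⋃₀ P = R

/-- A finite clopen partition of a topological space `Z`. -/
def IsClopenPartitionSpace (Z : Type u) [TopologicalSpace Z] (P : Set (Set Z)) : Prop :=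
  P.Finite ∧ (∀ U ∈ P, U.Nonempty ∧ IsClopen U) ∧ P.PairwiseDisjoint id ∧ ⋃₀ P = Set.univ

/-- A groupoid partition of the CEER `(R, T)`. -/
def IsGroupoidPartition {X : Type u} [TopologicalSpace X] (R : Set (X × X))
    (T : TopologicalSpace ↥R) (P : Set (Set (X × X))) : Prop :=
  IsClopenPartitionRel R T P ∧
    (∀ U ∈ P, U ⊆ Set.diagonal X ∨ U ⊆ R \ Set.diagonal X) ∧
    (∀ U ∈ P,
      @Topology.IsEmbedding ↥U X (relSubTop T U) _ (fun p => (p : X × X).1) ∧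
      @Topology.IsEmbedding ↥U X (relSubTop T U) _ (fun p => (p : X × X).2)) ∧
    (∀ U ∈ P, U ⊆ R \ Set.diagonal X → (Prod.fst '' U) ∩ (Prod.snd '' U) = ∅) ∧
    (∀ U ∈ P, ∀ V ∈ P, SetComp U V = ∅ ∨ SetComp U V ∈ P) ∧
    (∀ U ∈ P, SetInv U ∈ P)

/-- The trace on the diagonal of a partition of `R`, viewed as a family of subsets of `X`. -/
def diagTrace {X : Type u} (P : Set (Set (X × X))) : Set (Set X) :=
  {A | ∃ U ∈ P, U ⊆ Set.diagonal X ∧ A = Prod.fst '' U}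

/-! ### Restriction to a closed subset -/

/-- The restriction `R|_Y` of `R ⊆ X × X` to `Y ⊆ X`, as a relation on `↥Y`. -/
def restrictRel {X : Type u} (R : Set (X × X)) (Y : Set X) : Set (↥Y × ↥Y) :=
  {p | ((p.1 : X), (p.2 : X)) ∈ R}

/-- The relative topology on `R|_Y` induced from `(R, T)`. -/
def restrictTop {X : Type u} [TopologicalSpace X] (R : Set (X × X))
    (T : TopologicalSpace ↥R) (Y : Set X) : TopologicalSpace ↥(restrictRel R Y) :=
  TopologicalSpace.induced
    (fun p : ↥(restrictRel R Y) => (⟨((p.1.1 : X), (p.1.2 : X)), p.2⟩ : ↥R)) T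

/-! ### Fibred products, transversality, joins -/

/-- The fibred product `R ×_X S`. -/
abbrev Fib {X : Type u} (R S : Set (X × X)) : Type u :=
  {q : ↥R × ↥S // (q.1 : X × X).2 = (q.2 : X × X).1}

/-- The range map `r((x,y),(y,z)) = x` on `R ×_X S`. -/
def fibR {X : Type u} {R S : Set (X × X)} (q : Fib R S) : X := (q.1.1 : X × X).1

/-- The source map `s((x,y),(y,z)) = z` on `R ×_X S`. -/
def fibS {X : Type u} {R S : Set (X × X)} (q : Fib R S) : X := (q.1.2 : X × X).2

/-- The relative topology on `R ×_X S` from the product of `(R, T)` and `(S, T')`. -/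
def fibTop {X : Type u} {R S : Set (X × X)} (T : TopologicalSpace ↥R)
    (T' : TopologicalSpace ↥S) : TopologicalSpace (Fib R S) :=
  letI := T; letI := T'; inferInstance

/-- `(R, T)` and `(S, T')` are transverse: `R ∩ S = Δ_X` and there is a homeomorphism
`h : R ×_X S → S ×_X R` with `r ∘ h = r` and `s ∘ h = s`. -/
def AreTransverse {X : Type u} [TopologicalSpace X] (R : Set (X × X))
    (T : TopologicalSpace ↥R) (S : Set (X × X)) (T' : TopologicalSpace ↥S) : Prop :=
  R ∩ S = Set.diagonal X ∧
    ∃ h : Fib R S → Fib S R,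
      @IsHomeomorph _ _ (fibTop T T') (fibTop T' T) h ∧
      (∀ q, fibR (h q) = fibR q) ∧ (∀ q, fibS (h q) = fibS q)

/-- The equivalence relation `R ∨ S` generated by `R` and `S`. -/
def joinRel {X : Type u} (R S : Set (X × X)) : Set (X × X) :=
  {p | Relation.EqvGen (fun a b => (a, b) ∈ R ∨ (a, b) ∈ S) p.1 p.2}

/-- The map `r × s : R ×_X S → R ∨ S`. -/
def rsFun {X : Type u} (R S : Set (X × X)) : Fib R S → ↥(joinRel R S) := fun q =>
  ⟨(fibR q, fibS q), by
    have h1 : ((q.1.1 : X × X).1, (q.1.1 : X × X).2) ∈ R := q.1.1.2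
    have h2 : ((q.1.1 : X × X).2, (q.1.2 : X × X).2) ∈ S := by
      rw [show ((q.1.1 : X × X)).2 = ((q.1.2 : X × X)).1 from q.2]
      exact q.1.2.2
    exact Relation.EqvGen.trans _ _ _ (Relation.EqvGen.rel _ _ (Or.inl h1))
      (Relation.EqvGen.rel _ _ (Or.inr h2))⟩

/-- The topology on `R ∨ S` transferred from `R ×_X S` via the bijection `r × s`. -/
def joinTop {X : Type u} [TopologicalSpace X] (R S : Set (X × X))
    (T : TopologicalSpace ↥R) (T' : TopologicalSpace ↥S) :
    TopologicalSpace ↥(joinRel R S) :=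
  TopologicalSpace.coinduced (rsFun R S) (fibTop T T')

/-- The topology on an image `f '' s` transferred from a topology on `s` via `f`. -/
def imageTop {α : Type u} {β : Type v} (s : Set α) (Ts : TopologicalSpace ↥s)
    (f : α → β) : TopologicalSpace ↥(f '' s) :=
  TopologicalSpace.coinduced (fun p : ↥s => ⟨f p.1, ⟨p.1, p.2, rfl⟩⟩) Ts
/-! ### Bratteli diagrams -/

/-- A (standard) Bratteli diagram. `V n` is the (finite, nonempty) vertex set at level `n`
(`V 0` a singleton), and `E n` is the edge set connecting level `n` to level `n + 1`
(so `E n` plays the role of `E_{n+1}` in the paper), with source map `src n : E n → V n`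
and range map `rng n : E n → V (n+1)`, both surjective. -/
structure BratteliDiagram : Type 1 where
  V : ℕ → Type
  E : ℕ → Type
  fin_V : ∀ n, Finite (V n)
  fin_E : ∀ n, Finite (E n)
  nonempty_V : ∀ n, Nonempty (V n)
  nonempty_E : ∀ n, Nonempty (E n)
  subsingleton_V0 : Subsingleton (V 0)
  src : ∀ n, E n → V n
  rng : ∀ n, E n → V (n + 1)
  src_surj : ∀ n, Function.Surjective (src n)
  rng_surj : ∀ n, Function.Surjective (rng n)

namespace BratteliDiagram

/-- The path space `X_{(V,E)}` of a Bratteli diagram. -/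
abbrev pathSpace (B : BratteliDiagram) : Type :=
  {x : ∀ n, B.E n // ∀ n, B.rng n (x n) = B.src (n + 1) (x (n + 1))}

/-- The topology on the path space: the relative topology from `∏ n, E n`
with each `E n` discrete. -/
def pathTop (B : BratteliDiagram) : TopologicalSpace B.pathSpace :=
  letI : ∀ n, TopologicalSpace (B.E n) := fun _ => ⊥
  inferInstance

/-- `AF_n(V,E)`: cofinality from level `n` on. -/
def AFn (B : BratteliDiagram) (n : ℕ) : Set (B.pathSpace × B.pathSpace) :=
  {p | ∀ m, n ≤ m → p.1.1 m = p.2.1 m}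

/-- The relative topology on `AF_n(V,E)` from `X_{(V,E)} × X_{(V,E)}`. -/
def AFnTop (B : BratteliDiagram) (n : ℕ) : TopologicalSpace ↥(B.AFn n) :=
  letI := B.pathTop
  inferInstance

/-- The cofinality relation `AF(V,E) = ⋃ n, AF_n(V,E)`. -/
def AF (B : BratteliDiagram) : Set (B.pathSpace × B.pathSpace) :=
  ⋃ n, B.AFn n

/-- The inductive limit topology on `AF(V,E)`. -/
def AFTop (B : BratteliDiagram) : TopologicalSpace ↥B.AF :=
  ⨆ n, TopologicalSpace.coinduced
    (fun p : ↥(B.AFn n) => (⟨p.1, Set.mem_iUnion.mpr ⟨n, p.2⟩⟩ : ↥B.AF)) (B.AFnTop n)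

/-- A Bratteli diagram is simple if for every level `n` there is a later level such that
every vertex at level `n` is connected by a path of edges to every vertex at that level. -/
def IsSimple (B : BratteliDiagram) : Prop :=
  ∀ n : ℕ, ∃ k : ℕ, ∀ (v : B.V n) (w : B.V (n + k + 1)),
    ∃ es : ∀ j, B.E j, B.src n (es n) = v ∧ B.rng (n + k) (es (n + k)) = w ∧
      ∀ j, n ≤ j → j + 1 ≤ n + k → B.rng j (es j) = B.src (j + 1) (es (j + 1))

end BratteliDiagram

/-- `Fs` determines an (edge) Bratteli subdiagram of `B`. -/
def IsSubdiagram (B : BratteliDiagram) (Fs : ∀ n, Set (B.E n)) : Prop :=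
  (∀ n, (Fs n).Nonempty) ∧ ∀ n, B.src (n + 1) '' Fs (n + 1) = B.rng n '' Fs n

/-- Vertex sets of the subdiagram determined by `Fs`. -/
def subVertex (B : BratteliDiagram) (Fs : ∀ n, Set (B.E n)) : ℕ → Type
  | 0 => B.V 0
  | n + 1 => ↥(B.rng n '' Fs n)

/-- The Bratteli subdiagram of `B` determined by `Fs`, as a Bratteli diagram. -/
def subdiagramB (B : BratteliDiagram) (Fs : ∀ n, Set (B.E n))
    (h : IsSubdiagram B Fs) : BratteliDiagram where
  V := subVertex B Fs
  E n := ↥(Fs n)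
  fin_V n := by
    cases n with
    | zero => exact B.fin_V 0
    | succ m => haveI := B.fin_V (m + 1); exact inferInstanceAs (Finite ↥(B.rng m '' Fs m))
  fin_E n := by haveI := B.fin_E n; exact inferInstanceAs (Finite ↥(Fs n))
  nonempty_V n := by
    cases n with
    | zero => exact B.nonempty_V 0
    | succ m =>
      obtain ⟨e, he⟩ := h.1 m
      exact ⟨⟨B.rng m e, ⟨e, he, rfl⟩⟩⟩
  nonempty_E n := by obtain ⟨e, he⟩ := h.1 n; exact ⟨⟨e, he⟩⟩
  subsingleton_V0 := B.subsingleton_V0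
  src n := match n with
    | 0 => fun e => B.src 0 e.1
    | m + 1 => fun e =>
      ⟨B.src (m + 1) e.1, by rw [← h.2 m]; exact ⟨e.1, e.2, rfl⟩⟩
  rng n := fun e => ⟨B.rng n e.1, ⟨e.1, e.2, rfl⟩⟩
  src_surj n := by
    cases n with
    | zero =>
      intro v
      haveI : Subsingleton (subVertex B Fs 0) := B.subsingleton_V0
      obtain ⟨e, he⟩ := h.1 0
      exact ⟨⟨e, he⟩, Subsingleton.elim _ _⟩
    | succ m =>
      intro v
      obtain ⟨vv, hvv⟩ := v
      rw [← h.2 m] at hvv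
      obtain ⟨e, he, hev⟩ := hvv
      exact ⟨⟨e, he⟩, Subtype.ext hev⟩
  rng_surj n := by
    intro v
    obtain ⟨vv, hv⟩ := v
    obtain ⟨e, he, hev⟩ := hv
    exact ⟨⟨e, he⟩, Subtype.ext hev⟩

/-! ### Orbit equivalence relation of a group action -/

/-- The orbit equivalence relation `R_G = {(x, g•x)}` of a group action. -/
def orbitRelSet (G : Type v) (X : Type u) [Group G] [MulAction G X] : Set (X × X) :=
  {p | ∃ g : G, p.2 = g • p.1}

/-- The topology on `R_G` transferred from the product topology on `X × G`
(`G` discrete) via the bijection `(x, g) ↦ (x, g • x)`. -/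
def orbitRelTop (G : Type v) (X : Type u) [TopologicalSpace X] [Group G] [MulAction G X] :
    TopologicalSpace ↥(orbitRelSet G X) :=
  letI : TopologicalSpace G := ⊥
  TopologicalSpace.coinduced
    (fun q : X × G => (⟨(q.1, q.2 • q.1), ⟨q.2, rfl⟩⟩ : ↥(orbitRelSet G X))) inferInstance

theorem ceer_top_eq {X : Type} [TopologicalSpace X] [T2Space X]
    (S : Set (X × X)) (T' : TopologicalSpace ↥S) (hS : IsCEER S T') : T' = relTop S := by
  letI := T'
  obtain ⟨hE, hC⟩ := hS
  have h1 : Continuous (fun p : ↥S => (p : X × X).1) := hE.localHomeo_range.continuous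
  have h2 : Continuous (fun p : ↥S => (p : X × X).2) :=
    h1.comp hE.homeo_inv.continuous
  have h3 : Continuous (fun p : ↥S => (p : X × X)) := h1.prodMk h2
  have h4 := h3.isClosedEmbedding Subtype.val_injective
  exact h4.eq_induced

theorem indlim_isOpen {X : Type} [TopologicalSpace X] (R : Set (X × X))
    (Rseq : ℕ → Set (X × X)) (hsub : ∀ n, Rseq n ⊆ R) (U : Set ↥R) :
    IsOpen[inductiveLimitTop R Rseq hsub] U ↔
      ∀ n, IsOpen ((fun p : ↥(Rseq n) => (⟨(p : X × X), hsub n p.2⟩ : ↥R)) ⁻¹' U) := by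
  unfold inductiveLimitTop
  rw [isOpen_iSup_iff]
  exact Iff.rfl

/-- A clopen subequivalence relation of a CEER (relative topology) is a CEER. -/
theorem ceer_of_clopen {X : Type} [TopologicalSpace X] [T2Space X]
    [SecondCountableTopology X]
    (R Q : Set (X × X)) (hR : IsCEER R (relTop R)) (hQR : Q ⊆ R)
    (hrefl : ∀ x, (x, x) ∈ Q) (hsymm : ∀ ⦃x y : X⦄, (x, y) ∈ Q → (y, x) ∈ Q)
    (htrans : ∀ ⦃x y z : X⦄, (x, y) ∈ Q → (y, z) ∈ Q → (x, z) ∈ Q)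
    (hcl : IsClopen ((Subtype.val : ↥R → X × X) ⁻¹' Q)) : IsCEER Q (relTop Q) := by
  obtain ⟨hE, hC⟩ := hR
  have hC' : CompactSpace ↥R := hC
  have hemb : IsOpenEmbedding (Set.inclusion hQR) := by
    refine ⟨IsEmbedding.inclusion hQR, ?_⟩
    rw [Set.range_inclusion]
    exact hcl.isOpen
  have hcomp : CompactSpace ↥Q := by
    have hce : IsClosedEmbedding (Set.inclusion hQR) := by
      refine ⟨IsEmbedding.inclusion hQR, ?_⟩
      rw [Set.range_inclusion]
      exact hcl.isClosed
    exact hce.compactSpace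
  have hinv : Continuous (invMap Q hsymm) := by
    unfold invMap
    fun_prop
  refine ⟨⟨hrefl, hsymm, htrans, ?_, ?_, ?_, ?_, ?_, ?_, ?_⟩, hcomp⟩
  · intro x
    exact (hE.countable x).mono fun y hy => hQR hy
  · exact inferInstanceAs (T2Space ↥Q)
  · exact inferInstanceAs (LocallyCompactSpace ↥Q)
  · exact inferInstanceAs (SecondCountableTopology ↥Q)
  · change Continuous (compMap Q htrans)
    unfold compMap
    fun_prop
  · change IsHomeomorph (invMap Q hsymm)
    exact (Homeomorph.mk (Equiv.mk (invMap Q hsymm) (invMap Q hsymm) (fun _ => rfl)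
      (fun _ => rfl)) hinv hinv).isHomeomorph
  · have h1 : IsLocalHomeomorph (fun p : ↥R => (p : X × X).1) := hE.localHomeo_range
    exact h1.comp hemb.isLocalHomeomorph

theorem pullback_snd_open {A B Z : Type} [TopologicalSpace A] [TopologicalSpace B]
    [TopologicalSpace Z] (f : A → Z) (g : B → Z) (hf : IsOpenMap f) (hg : Continuous g) :
    IsOpenMap (fun q : {q : A × B // f q.1 = g q.2} => q.1.2) := by
  intro U hU
  obtain ⟨V, hV, rfl⟩ := isOpen_induced_iff.1 hU
  rw [isOpen_iff_forall_mem_open]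
  rintro b ⟨⟨⟨a, b⟩, hab⟩, hq, rfl⟩
  obtain ⟨u, v, hu, hv, ha, hb, huv⟩ := isOpen_prod_iff.1 hV a b hq
  refine ⟨v ∩ g ⁻¹' (f '' u), ?_, hv.inter ((hf u hu).preimage hg), hb, a, ha, hab⟩
  rintro b' ⟨hb', a', ha', h'⟩
  exact ⟨⟨(a', b'), h'⟩, huv ⟨ha', hb'⟩, rfl⟩

/-- The open-ness of each `R n` in the inductive limit topology. -/
theorem mono_open {X : Type} [TopologicalSpace X]
    (Rseq : ℕ → Set (X × X)) (hmono : ∀ n, Rseq n ⊆ Rseq (n + 1))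
    (hopen : ∀ n, IsOpen[relTop (Rseq (n + 1))]
      ((Subtype.val : ↥(Rseq (n + 1)) → X × X) ⁻¹' Rseq n)) (n m : ℕ) :
    IsOpen ((Subtype.val : ↥(Rseq m) → X × X) ⁻¹' Rseq n) := by
  have hM : Monotone Rseq := monotone_nat_of_le_succ hmono
  rcases le_total m n with h | h
  · have : ((Subtype.val : ↥(Rseq m) → X × X) ⁻¹' Rseq n) = univ := by
      ext p; simpa using hM h p.2
    rw [this]; exact isOpen_univ
  · induction m, h using Nat.le_induction with
    | base =>
      have : ((Subtype.val : ↥(Rseq n) → X × X) ⁻¹' Rseq n) = univ := by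
        ext p; simp
      rw [this]; exact isOpen_univ
    | succ m h ih =>
      obtain ⟨V, hV, hVe⟩ := isOpen_induced_iff.1 ih
      have h1 : IsOpen ((Subtype.val : ↥(Rseq (m + 1)) → X × X) ⁻¹' Rseq m) := hopen m
      have : ((Subtype.val : ↥(Rseq (m + 1)) → X × X) ⁻¹' Rseq n) =
          ((Subtype.val : ↥(Rseq (m + 1)) → X × X) ⁻¹' Rseq m) ∩ Subtype.val ⁻¹' V := by
        ext ⟨p, hp⟩
        constructor
        · intro hq
          have hq' : p ∈ Rseq n := hq
          refine ⟨hM h hq', ?_⟩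
          have : (⟨p, hM h hq'⟩ : ↥(Rseq m)) ∈ (Subtype.val ⁻¹' V : Set ↥(Rseq m)) := by
            rw [hVe]; exact hq'
          exact this
        · rintro ⟨hq1, hq2⟩
          have : (⟨p, hq1⟩ : ↥(Rseq m)) ∈ (Subtype.val ⁻¹' Rseq n : Set ↥(Rseq m)) := by
            rw [← hVe]; exact hq2
          exact this
      rw [this]
      exact h1.inter (hV.preimage continuous_subtype_val)

/-- The transport map. -/
theorem transport_exists {X : Type} [TopologicalSpace X] [T2Space X]
    (R : Set (X × X)) (T : TopologicalSpace ↥R)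
    (Rseq : ℕ → Set (X × X)) (hsub : ∀ n, Rseq n ⊆ R)
    (hmono : ∀ n, Rseq n ⊆ Rseq (n + 1))
    (hceer : ∀ n, IsCEER (Rseq n) (relTop (Rseq n)))
    (hopen : ∀ n, IsOpen[relTop (Rseq (n + 1))]
      ((Subtype.val : ↥(Rseq (n + 1)) → X × X) ⁻¹' Rseq n))
    (hT : T = inductiveLimitTop R Rseq hsub)
    (S : Set (X × X)) (htr : AreTransverse R T S (relTop S)) (n : ℕ) :
    ∃ g : Fib S (Rseq n) → X × X, (∀ q, g q ∈ R ∧ (g q).1 = q.1.1.1.1 ∧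
      ((g q).2, q.1.2.1.2) ∈ S) ∧ ∀ m, IsClopen {q | g q ∈ Rseq m} := by
  letI := T
  obtain ⟨-, h, hh, hr, hs⟩ := htr
  have hh' : IsHomeomorph h := hh
  let e := hh'.homeomorph h
  have hincl : ∀ m, Continuous (fun p : ↥(Rseq m) => (⟨p.1, hsub m p.2⟩ : ↥R)) := by
    intro m
    refine ⟨fun U hU => ?_⟩
    have hU' : IsOpen[inductiveLimitTop R Rseq hsub] U := hT ▸ hU
    exact (indlim_isOpen R Rseq hsub U).1 hU' m
  have hval : Continuous (Subtype.val : ↥R → X × X) := by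
    refine ⟨fun U hU => ?_⟩
    have : IsOpen[inductiveLimitTop R Rseq hsub] ((Subtype.val : ↥R → X × X) ⁻¹' U) := by
      rw [indlim_isOpen]
      intro m
      exact hU.preimage continuous_subtype_val
    rw [← hT] at this
    exact this
  have hT2 : T2Space ↥R := T2Space.of_injective_continuous Subtype.val_injective hval
  have hcl : ∀ m, IsClopen ((Subtype.val : ↥R → X × X) ⁻¹' Rseq m) := by
    intro m
    constructor
    · have : CompactSpace ↥(Rseq m) := (hceer m).2
      have h1 := (isCompact_range (hincl m)).isClosed
      convert h1
      ext p
      constructor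
      · intro hp; exact ⟨⟨p.1, hp⟩, rfl⟩
      · rintro ⟨q, rfl⟩; exact q.2
    · have : IsOpen[inductiveLimitTop R Rseq hsub] ((Subtype.val : ↥R → X × X) ⁻¹' Rseq m) := by
        rw [indlim_isOpen]
        intro k
        exact mono_open Rseq hmono hopen m k
      rw [← hT] at this
      exact this
  let ι : Fib S (Rseq n) → Fib S R := fun q =>
    ⟨(q.1.1, ⟨q.1.2.1, hsub n q.1.2.2⟩), q.2⟩
  have hι : Continuous ι := by
    refine Continuous.subtype_mk ?_ _
    exact (continuous_fst.comp continuous_subtype_val).prodMk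
      ((hincl n).comp (continuous_snd.comp continuous_subtype_val))
  have hes : ∀ q, h (e.symm q) = q := fun q => e.apply_symm_apply q
  let φ : Fib S (Rseq n) → ↥R := fun q => (e.symm (ι q)).1.1
  have hφ : Continuous φ :=
    continuous_fst.comp (continuous_subtype_val.comp (e.symm.continuous.comp hι))
  refine ⟨fun q => (φ q).1, fun q => ⟨(φ q).2, ?_, ?_⟩, fun m => (hcl m).preimage hφ⟩
  · have := hr (e.symm (ι q))
    rw [hes] at this
    exact this.symm
  · have := hs (e.symm (ι q))
    rw [hes] at this
    have h2 := (e.symm (ι q)).2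
    have h3 := (e.symm (ι q)).1.2.2
    have h4 : (φ q).1.2 = (e.symm (ι q)).1.2.1.1 := h2
    rw [h4]
    have h5 : q.1.2.1.2 = (e.symm (ι q)).1.2.1.2 := this
    rw [h5]
    exact h3

theorem af_transverse_exhaustion {X : Type} [TopologicalSpace X] [CompactSpace X]
    [TopologicalSpace.MetrizableSpace X] [TotallyDisconnectedSpace X]
    (R : Set (X × X)) (T : TopologicalSpace ↥R)
    (Rseq : ℕ → Set (X × X)) (hsub : ∀ n, Rseq n ⊆ R)
    (h0 : Rseq 0 = Set.diagonal X) (hmono : ∀ n, Rseq n ⊆ Rseq (n + 1))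
    (hceer : ∀ n, IsCEER (Rseq n) (relTop (Rseq n)))
    (hopen : ∀ n, IsOpen[relTop (Rseq (n + 1))]
      ((Subtype.val : ↥(Rseq (n + 1)) → X × X) ⁻¹' Rseq n))
    (hunion : (⋃ n, Rseq n) = R) (hT : T = inductiveLimitTop R Rseq hsub)
    (S : Set (X × X)) (T' : TopologicalSpace ↥S) (hS : IsCEER S T')
    (htr : AreTransverse R T S T') :
    ∃ (R'seq : ℕ → Set (X × X)) (hsub' : ∀ n, R'seq n ⊆ R),
      R'seq 0 = Set.diagonal X ∧
      (∀ n, R'seq n ⊆ R'seq (n + 1)) ∧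
      (∀ n, IsCEER (R'seq n) (relTop (R'seq n))) ∧
      (∀ n, IsOpen[relTop (R'seq (n + 1))]
        ((Subtype.val : ↥(R'seq (n + 1)) → X × X) ⁻¹' R'seq n)) ∧
      (⋃ n, R'seq n) = R ∧
      T = inductiveLimitTop R R'seq hsub' ∧
      ∀ n, AreTransverse (R'seq n) (relTop (R'seq n)) S T' := by
  obtain rfl : T' = relTop S := ceer_top_eq S T' hS
  haveI : SecondCountableTopology X := by
    letI := TopologicalSpace.metrizableSpaceMetric X
    infer_instance
  have hM : Monotone Rseq := monotone_nat_of_le_succ hmono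
  have hSc : CompactSpace ↥S := hS.2
  have hRc : ∀ n, CompactSpace ↥(Rseq n) := fun n => (hceer n).2
  have hRS := htr.1
  have Srefl := hS.1.refl
  have Ssymm := hS.1.symm
  have Strans := hS.1.trans
  have Rmem : ∀ {p}, p ∈ R → ∃ n, p ∈ Rseq n := by
    intro p hp; rw [← hunion] at hp; exact mem_iUnion.1 hp
  have Rsymm : ∀ {x y : X}, (x, y) ∈ R → (y, x) ∈ R := by
    intro x y hp
    obtain ⟨n, hn⟩ := Rmem hp
    exact hsub n ((hceer n).1.symm hn)
  have Rtrans : ∀ {x y z : X}, (x, y) ∈ R → (y, z) ∈ R → (x, z) ∈ R := by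
    intro x y z h1 h2
    obtain ⟨n, hn⟩ := Rmem h1
    obtain ⟨m, hm⟩ := Rmem h2
    exact hsub (max n m) ((hceer _).1.trans (hM (le_max_left n m) hn) (hM (le_max_right n m) hm))
  have RSeq : ∀ {x y : X}, (x, y) ∈ R → (x, y) ∈ S → x = y := by
    intro x y h1 h2
    have : (x, y) ∈ R ∩ S := ⟨h1, h2⟩
    rw [hRS] at this
    exact this
  have htrans := fun n => transport_exists R T Rseq hsub hmono hceer hopen hT S htr n
  have hB : ∀ {x y z : X}, (x, y) ∈ S → (y, z) ∈ R → ∃ w, (x, w) ∈ R ∧ (w, z) ∈ S := by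
    intro x y z h1 h2
    obtain ⟨n, hn⟩ := Rmem h2
    obtain ⟨g, hg, -⟩ := htrans n
    obtain ⟨a, b, c⟩ := hg ⟨(⟨(x, y), h1⟩, ⟨(y, z), hn⟩), rfl⟩
    refine ⟨_, ?_, c⟩
    generalize g ⟨(⟨(x, y), h1⟩, ⟨(y, z), hn⟩), rfl⟩ = t at a b c
    have b' : t.1 = x := b
    rw [← b']
    exact a
  let R' : ℕ → Set (X × X) := fun n =>
    {p | p ∈ Rseq n ∧ ∀ w z, (p.1, w) ∈ S → (p.2, z) ∈ S → (w, z) ∈ R → (w, z) ∈ Rseq n}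
  have hR'R : ∀ n, R' n ⊆ Rseq n := fun n p hp => hp.1
  have hsub' : ∀ n, R' n ⊆ R := fun n p hp => hsub n hp.1
  have R'refl : ∀ n x, (x, x) ∈ R' n := by
    intro n x
    refine ⟨(hceer n).1.refl x, fun w z h1 h2 h3 => ?_⟩
    obtain rfl := RSeq h3 (Strans (Ssymm h1) h2)
    exact (hceer n).1.refl _
  have R'symm : ∀ n ⦃x y : X⦄, (x, y) ∈ R' n → (y, x) ∈ R' n := by
    intro n x y hp
    exact ⟨(hceer n).1.symm hp.1, fun w z h1 h2 h3 =>
      (hceer n).1.symm (hp.2 z w h2 h1 (Rsymm h3))⟩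
  have R'trans : ∀ n ⦃x y z : X⦄, (x, y) ∈ R' n → (y, z) ∈ R' n → (x, z) ∈ R' n := by
    intro n x y u h1 h2
    refine ⟨(hceer n).1.trans h1.1 h2.1, fun w v hw hv hwv => ?_⟩
    obtain ⟨z, hz1, hz2⟩ := hB (Ssymm hw) (hsub n h1.1)
    exact (hceer n).1.trans (h1.2 w z hw (Ssymm hz2) hz1)
      (h2.2 z v (Ssymm hz2) hv (Rtrans (Rsymm hz1) hwv))
  have R'inv : ∀ n {x y w z : X}, (x, y) ∈ R' n → (x, w) ∈ S → (y, z) ∈ S → (w, z) ∈ R →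
      (w, z) ∈ R' n := by
    intro n x y w z h1 h2 h3 h4
    exact ⟨h1.2 w z h2 h3 h4, fun a b ha hb hab =>
      h1.2 a b (Strans h2 ha) (Strans h3 hb) hab⟩
  have R'mono : ∀ n, R' n ⊆ R' (n + 1) := fun n p hp =>
    ⟨hmono n hp.1, fun w z h1 h2 h3 => hmono n (hp.2 w z h1 h2 h3)⟩
  have hM' : Monotone R' := monotone_nat_of_le_succ R'mono
  have hgmem : ∀ (n : ℕ) (g : Fib S (Rseq n) → X × X), (∀ q, g q ∈ R ∧ (g q).1 = q.1.1.1.1 ∧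
      ((g q).2, q.1.2.1.2) ∈ S) → ∀ {x y w z : X} (hwx : (w, x) ∈ S) (hxy : (x, y) ∈ Rseq n),
      (y, z) ∈ S → (w, z) ∈ R → g ⟨(⟨(w, x), hwx⟩, ⟨(x, y), hxy⟩), rfl⟩ = (w, z) := by
    intro n g hg x y w z hwx hxy hyz hwz
    obtain ⟨a, b, c⟩ := hg ⟨(⟨(w, x), hwx⟩, ⟨(x, y), hxy⟩), rfl⟩
    generalize g ⟨(⟨(w, x), hwx⟩, ⟨(x, y), hxy⟩), rfl⟩ = t at a b c
    obtain ⟨t1, t2⟩ := t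
    have b' : t1 = w := b
    subst b'
    have c' : (t2, y) ∈ S := c
    rw [RSeq (Rtrans (Rsymm a) hwz) (Strans c' hyz)]
  have hFc : ∀ n, CompactSpace (Fib S (Rseq n)) := by
    intro n
    have : IsClosed {q : ↥S × ↥(Rseq n) | (q.1 : X × X).2 = (q.2 : X × X).1} :=
      isClosed_eq (by fun_prop) (by fun_prop)
    exact this.isClosedEmbedding_subtypeVal.compactSpace
  have hclopen : ∀ n, IsClopen ((Subtype.val : ↥(Rseq n) → X × X) ⁻¹' R' n) := by
    intro n
    haveI := hFc n
    obtain ⟨g, hg, hgc⟩ := htrans n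
    have hπc : Continuous (fun q : Fib S (Rseq n) => q.1.2) := by fun_prop
    have hsopen : IsOpenMap (fun p : ↥S => (p : X × X).2) := by
      have h1 : IsOpenMap (fun p : ↥S => (p : X × X).1) := hS.1.localHomeo_range.isOpenMap
      have h2 : IsHomeomorph (invMap S Ssymm) := hS.1.homeo_inv
      exact h1.comp h2.isOpenMap
    have hπo : IsOpenMap (fun q : Fib S (Rseq n) => q.1.2) :=
      pullback_snd_open (fun p : ↥S => (p : X × X).2) (fun p : ↥(Rseq n) => (p : X × X).1)
        hsopen (by fun_prop)
    have hπcl : IsClosedMap (fun q : Fib S (Rseq n) => q.1.2) := hπc.isClosedMap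
    have hK := (hgc n).compl
    have key : ((Subtype.val : ↥(Rseq n) → X × X) ⁻¹' R' n) =
        ((fun q : Fib S (Rseq n) => q.1.2) '' {q | g q ∈ Rseq n}ᶜ)ᶜ := by
      ext ⟨⟨x, y⟩, hp⟩
      constructor
      · rintro hp' ⟨⟨⟨⟨⟨w, x'⟩, hw⟩, p⟩, hq⟩, hbad, he⟩
        have he' : p = ⟨(x, y), hp⟩ := he
        subst he'
        have hq' : x' = x := hq
        subst hq'
        obtain ⟨a, b, c⟩ := hg ⟨(⟨(w, x'), hw⟩, ⟨(x', y), hp⟩), hq⟩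
        apply hbad
        have hp2 : (x', y) ∈ R' n := hp'
        have b' : _ = w := b
        refine hp2.2 _ _ ?_ (Ssymm c) a
        rw [b']
        exact Ssymm hw
      · intro hno
        refine ⟨hp, fun w z h1 h2 h3 => ?_⟩
        by_contra hwz
        apply hno
        refine ⟨⟨(⟨(w, x), Ssymm h1⟩, ⟨(x, y), hp⟩), rfl⟩, ?_, rfl⟩
        intro hgq
        apply hwz
        rw [← hgmem n g hg (Ssymm h1) hp h2 h3]
        exact hgq
    rw [key]
    exact ⟨(hπo _ hK.isOpen).isClosed_compl, (hπcl _ hK.isClosed).isOpen_compl⟩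
  have hunion' : (⋃ n, R' n) = R := by
    apply Subset.antisymm (iUnion_subset hsub')
    rintro ⟨x, y⟩ hp
    obtain ⟨n, hn⟩ := Rmem hp
    haveI := hFc n
    obtain ⟨g, hg, hgc⟩ := htrans n
    obtain ⟨m, hm⟩ := isCompact_univ.elim_directed_cover (fun m => {q | g q ∈ Rseq m})
      (fun m => (hgc m).isOpen) (fun q _ => by
        obtain ⟨m, hm⟩ := Rmem (hg q).1
        exact mem_iUnion.2 ⟨m, hm⟩)
      (directed_of_isDirected_le (fun a b hab q hq => hM hab hq))
    refine mem_iUnion.2 ⟨max n m, hM (le_max_left n m) hn, fun w z h1 h2 h3 => ?_⟩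
    apply hM (le_max_right n m)
    rw [← hgmem n g hg (Ssymm h1) hn h2 h3]
    exact hm (mem_univ _)
  have hopen' : ∀ n m, n ≤ m → ∀ U : Set (X × X), IsOpen U →
      IsOpen ((Subtype.val : ↥(Rseq m) → X × X) ⁻¹' (R' n ∩ U)) := by
    intro n m _ U hU
    obtain ⟨V, hV, hVe⟩ := isOpen_induced_iff.1 (hclopen n).isOpen
    have h1 := mono_open Rseq hmono hopen n m
    have : ((Subtype.val : ↥(Rseq m) → X × X) ⁻¹' (R' n ∩ U)) =
        ((Subtype.val : ↥(Rseq m) → X × X) ⁻¹' Rseq n) ∩ Subtype.val ⁻¹' (V ∩ U) := by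
      have hVe' : ∀ p, p ∈ Rseq n → (p ∈ V ↔ p ∈ R' n) := fun p hp =>
        Set.ext_iff.1 hVe ⟨p, hp⟩
      ext ⟨p, hp⟩
      constructor
      · rintro ⟨h1, h2⟩
        exact ⟨hR'R n h1, (hVe' p (hR'R n h1)).2 h1, h2⟩
      · rintro ⟨h1, h2, h3⟩
        exact ⟨(hVe' p h1).1 h2, h3⟩
    rw [this]
    exact h1.inter ((hV.inter hU).preimage continuous_subtype_val)
  refine ⟨R', hsub', ?_, R'mono, ?_, ?_, hunion', ?_, ?_⟩
  · apply Subset.antisymm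
    · rw [← h0]; exact hR'R 0
    · rintro ⟨x, y⟩ hxy
      have : x = y := hxy
      subst this
      exact R'refl 0 x
  · intro n
    exact ceer_of_clopen (Rseq n) (R' n) (hceer n) (hR'R n) (R'refl n) (R'symm n) (R'trans n)
      (hclopen n)
  · intro n
    have h1 := hopen' n (n + 1) (Nat.le_succ n) univ isOpen_univ
    rw [inter_univ] at h1
    exact h1.preimage (continuous_inclusion (hR'R (n + 1)))
  · rw [hT]
    refine TopologicalSpace.ext_iff.2 fun U => ?_
    rw [indlim_isOpen, indlim_isOpen]
    constructor
    · intro h n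
      exact (h n).preimage (continuous_inclusion (hR'R n))
    · intro h m
      rw [isOpen_iff_forall_mem_open]
      rintro ⟨p, hp⟩ hpU
      have hpR : p ∈ ⋃ n, R' n := by rw [hunion']; exact hsub m hp
      obtain ⟨k, hk⟩ := mem_iUnion.1 hpR
      obtain ⟨V, hV, hVe⟩ := isOpen_induced_iff.1 (h k)
      have hVe' : ∀ p (hp : p ∈ R' k), (p ∈ V ↔ (⟨p, hsub' k hp⟩ : ↥R) ∈ U) := fun p hp =>
        Set.ext_iff.1 hVe ⟨p, hp⟩
      have h2 := (hopen' k (max k m) (le_max_left k m) V hV).preimage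
        (continuous_inclusion (hM (le_max_right k m)))
      refine ⟨_, ?_, h2, ⟨hk, (hVe' p hk).2 hpU⟩⟩
      rintro ⟨q, hq⟩ ⟨hq1, hq2⟩
      exact (hVe' q hq1).1 hq2
  · intro n
    refine ⟨?_, ?_⟩
    · apply Subset.antisymm
      · rw [← hRS]; exact inter_subset_inter_left _ (hsub' n)
      · rintro ⟨x, y⟩ hxy
        have : x = y := hxy
        subst this
        exact ⟨R'refl n x, Srefl x⟩
    · obtain ⟨-, h, hh, hr, hs⟩ := htr
      let ι : Fib (R' n) S → Fib R S := fun q => ⟨(⟨q.1.1.1, hsub' n q.1.1.2⟩, q.1.2), q.2⟩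
      have hmem : ∀ q : Fib (R' n) S, (h (ι q)).1.2.1 ∈ R' n := by
        intro q
        have e1 := hr (ι q)
        have e2 := hs (ι q)
        obtain ⟨⟨⟨⟨x, y⟩, hxy⟩, ⟨⟨y', z⟩, hyz⟩⟩, hq⟩ := q
        have hq' : y = y' := hq
        subst hq'
        generalize h (ι _) = k at e1 e2
        obtain ⟨⟨⟨⟨a, b⟩, hab⟩, ⟨⟨b', c⟩, hbc⟩⟩, hk⟩ := k
        have hk' : b = b' := hk
        subst hk'
        have e1' : a = x := e1
        have e2' : c = z := e2
        subst e1' e2'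
        exact R'inv n hxy hab hyz hbc
      let h' : Fib (R' n) S → Fib S (R' n) := fun q =>
        ⟨((h (ι q)).1.1, ⟨(h (ι q)).1.2.1, hmem q⟩), (h (ι q)).2⟩
      refine ⟨h', ?_, fun q => hr (ι q), fun q => hs (ι q)⟩
      have hR'c : CompactSpace ↥(R' n) :=
        (ceer_of_clopen (Rseq n) (R' n) (hceer n) (hR'R n) (R'refl n) (R'symm n) (R'trans n)
          (hclopen n)).2
      have hFc' : CompactSpace (Fib (R' n) S) := by
        have : IsClosed {q : ↥(R' n) × ↥S | (q.1 : X × X).2 = (q.2 : X × X).1} :=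
          isClosed_eq (by fun_prop) (by fun_prop)
        exact this.isClosedEmbedding_subtypeVal.compactSpace
      change IsHomeomorph h'
      rw [isHomeomorph_iff_continuous_bijective]
      refine ⟨?_, ?_, ?_⟩
      · have hcont : Continuous (fun q : Fib (R' n) S => ((h (ι q)).1.1, (h (ι q)).1.2.1)) := by
          letI := T
          have hh' : IsHomeomorph h := hh
          have hincl : Continuous (fun p : ↥(R' n) => (⟨p.1, hsub' n p.2⟩ : ↥R)) := by
            refine ⟨fun U hU => ?_⟩
            have hU' : IsOpen[inductiveLimitTop R Rseq hsub] U := hT ▸ hU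
            exact ((indlim_isOpen R Rseq hsub U).1 hU' n).preimage
              (continuous_inclusion (hR'R n))
          have hval : Continuous (Subtype.val : ↥R → X × X) := by
            refine ⟨fun U hU => ?_⟩
            have : IsOpen[inductiveLimitTop R Rseq hsub]
                ((Subtype.val : ↥R → X × X) ⁻¹' U) := by
              rw [indlim_isOpen]
              intro m
              exact hU.preimage continuous_subtype_val
            rw [← hT] at this
            exact this
          have hι : Continuous ι := by
            refine Continuous.subtype_mk ?_ _
            exact (hincl.comp (continuous_fst.comp continuous_subtype_val)).prodMk
              (continuous_snd.comp continuous_subtype_val)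
          have h2 := continuous_subtype_val.comp (hh'.continuous.comp hι)
          exact (continuous_fst.comp h2).prodMk (hval.comp (continuous_snd.comp h2))
        refine Continuous.subtype_mk ?_ _
        exact (continuous_fst.comp hcont).prodMk
          (Continuous.subtype_mk (continuous_snd.comp hcont) _)
      · intro q1 q2 hq
        have h1 : h (ι q1) = h (ι q2) := by
          apply Subtype.ext
          apply Prod.ext
          · exact congrArg (fun k : Fib S (R' n) => k.1.1) hq
          · apply Subtype.ext
            exact congrArg (fun k : Fib S (R' n) => k.1.2.1) hq
        have h2 := hh.bijective.1 h1
        apply Subtype.ext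
        apply Prod.ext
        · apply Subtype.ext
          exact congrArg (fun k : Fib R S => k.1.1.1) h2
        · exact congrArg (fun k : Fib R S => k.1.2) h2
      · intro k
        obtain ⟨q, hq⟩ := hh.bijective.2
          (⟨(k.1.1, ⟨k.1.2.1, hsub' n k.1.2.2⟩), k.2⟩ : Fib S R)
        have hqm : q.1.1.1 ∈ R' n := by
          have e1 := hr q
          have e2 := hs q
          rw [hq] at e1 e2
          clear hq
          obtain ⟨⟨⟨⟨x, y⟩, hxy⟩, ⟨⟨y', z⟩, hyz⟩⟩, hq'⟩ := q
          obtain ⟨⟨⟨⟨a, b⟩, hab⟩, ⟨⟨b', c⟩, hbc⟩⟩, hk⟩ := k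
          have hk' : b = b' := hk
          subst hk'
          have hq'' : y = y' := hq'
          subst hq''
          have e1' : a = x := e1
          have e2' : c = z := e2
          subst e1' e2'
          exact R'inv n hbc (Ssymm hab) (Ssymm hyz) hxy
        refine ⟨⟨(⟨q.1.1.1, hqm⟩, q.1.2), q.2⟩, ?_⟩
        have hιq : ι ⟨(⟨q.1.1.1, hqm⟩, q.1.2), q.2⟩ = q := rfl
        apply Subtype.ext
        apply Prod.ext
        · change (h (ι ⟨(⟨q.1.1.1, hqm⟩, q.1.2), q.2⟩)).1.1 = k.1.1
          rw [hιq, hq]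
        · apply Subtype.ext
          change (h (ι ⟨(⟨q.1.1.1, hqm⟩, q.1.2), q.2⟩)).1.2.1 = k.1.2.1
          rw [hιq, hq]
end

section
/- Let (R,T) = lim (R_n,T_n) be an AF-equivalence relation on a compact, metrizable, zero-dimensional space X, and let S be a CEER on X such that R and S are transverse to each other. Then R ∨ S, equipped with the étale topology obtained by transferring the topology of R×_X S via the bijection r×s : R×_X S → R ∨ S, is an AF-equivalence relation on X. -/
open Set Topology MeasureTheory

universe u v

/-! ### Helper lemmas -/

theorem lh_of_open_locInj {A B : Type*} [TopologicalSpace A] [TopologicalSpace B] {f : A → B}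
    (hc : Continuous f) (ho : IsOpenMap f)
    (hi : ∀ a, ∃ U : Set A, IsOpen U ∧ a ∈ U ∧ Set.InjOn f U) : IsLocalHomeomorph f := by
  rw [isLocalHomeomorph_iff_isOpenEmbedding_restrict]
  intro a
  obtain ⟨U, hU, haU, hinj⟩ := hi a
  refine ⟨U, hU.mem_nhds haU, ?_⟩
  refine IsOpenEmbedding.of_continuous_injective_isOpenMap ?_ ?_ ?_
  · exact hc.comp continuous_subtype_val
  · exact hinj.injective
  · exact ho.comp hU.isOpenMap_subtype_val

theorem lh_locInj {A B : Type*} [TopologicalSpace A] [TopologicalSpace B] {f : A → B}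
    (hf : IsLocalHomeomorph f) (a : A) :
    ∃ U : Set A, IsOpen U ∧ a ∈ U ∧ Set.InjOn f U := by
  obtain ⟨e, hae, rfl⟩ := hf a
  exact ⟨e.source, e.open_source, hae, e.injOn⟩

theorem pb_fst_open {A B X : Type*} [TopologicalSpace A] [TopologicalSpace B]
    [TopologicalSpace X] {f : A → X} {g : B → X} (hf : Continuous f) (hg : IsOpenMap g) :
    IsOpenMap (fun q : {q : A × B // f q.1 = g q.2} => q.1.1) := by
  rw [isOpenMap_iff_nhds_le]
  rintro ⟨⟨a, b⟩, hab⟩ s hs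
  rw [Filter.mem_map] at hs
  rw [nhds_subtype_eq_comap, Filter.mem_comap] at hs
  obtain ⟨t, ht, hts⟩ := hs
  obtain ⟨u, hu, v, hv, huv⟩ := mem_nhds_prod_iff.1 ht
  have h1 : g '' v ∈ 𝓝 (f a) := by
    have := hg.image_mem_nhds hv
    rwa [← show f a = g b from hab] at this
  filter_upwards [hu, hf.continuousAt h1] with x hx hx'
  obtain ⟨y, hy, hyx⟩ := hx'
  exact hts (a := (⟨(x, y), hyx.symm⟩ : {q : A × B // f q.1 = g q.2})) (huv ⟨hx, hy⟩)

theorem pb_snd_open {A B X : Type*} [TopologicalSpace A] [TopologicalSpace B]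
    [TopologicalSpace X] {f : A → X} {g : B → X} (hf : IsOpenMap f) (hg : Continuous g) :
    IsOpenMap (fun q : {q : A × B // f q.1 = g q.2} => q.1.2) := by
  have h := pb_fst_open (f := g) (g := f) hg hf
  intro U hU
  have hcs : Continuous (fun q : {q : B × A // g q.1 = f q.2} =>
      (⟨(q.1.2, q.1.1), q.2.symm⟩ : {q : A × B // f q.1 = g q.2})) := by fun_prop
  convert h _ (hU.preimage hcs) using 1
  ext b
  constructor
  · rintro ⟨⟨⟨a, b⟩, hab⟩, hq, rfl⟩
    exact ⟨⟨(b, a), hab.symm⟩, hq, rfl⟩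
  · rintro ⟨⟨⟨b, a⟩, hab⟩, hq, rfl⟩
    exact ⟨_, hq, rfl⟩

theorem pb_fst_lh {A B X : Type*} [TopologicalSpace A] [TopologicalSpace B]
    [TopologicalSpace X] {f : A → X} {g : B → X} (hf : Continuous f)
    (hg : IsLocalHomeomorph g) :
    IsLocalHomeomorph (fun q : {q : A × B // f q.1 = g q.2} => q.1.1) := by
  refine lh_of_open_locInj (by fun_prop) (pb_fst_open hf hg.isOpenMap) ?_
  rintro ⟨⟨a, b⟩, hab⟩
  obtain ⟨U, hU, hbU, hinj⟩ := lh_locInj hg b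
  refine ⟨(fun q => q.1.2) ⁻¹' U, hU.preimage (by fun_prop), hbU, ?_⟩
  rintro ⟨⟨a, b⟩, hab⟩ h1 ⟨⟨a', b'⟩, hab'⟩ h2 (rfl : a = a')
  have : b = b' := hinj h1 h2 (by simp only at hab hab'; rw [← hab, hab'])
  subst this; rfl

theorem pb_closedEmb {A B X : Type*} [TopologicalSpace A] [TopologicalSpace B]
    [TopologicalSpace X] [T2Space X] {f : A → X} {g : B → X} (hf : Continuous f)
    (hg : Continuous g) :
    IsClosedEmbedding (Subtype.val : {q : A × B // f q.1 = g q.2} → A × B) :=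
  (isClosed_eq (hf.comp continuous_fst) (hg.comp continuous_snd)).isClosedEmbedding_subtypeVal

/-- The recognition lemma for AF-relations. -/
theorem af_of_data {X : Type u} [TopologicalSpace X] [CompactSpace X]
    [TopologicalSpace.MetrizableSpace X] {F : Type u} [TopologicalSpace F]
    (E : Set (X × X)) (φ : F → ↥E) (hb : Function.Bijective φ)
    (hc : Continuous (fun q => (φ q : X × X)))
    (hlh : IsLocalHomeomorph (fun q => (φ q : X × X).1))
    (Q : ℕ → Set (X × X)) (hsub : ∀ n, Q n ⊆ E) (h0 : Q 0 = Set.diagonal X)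
    (hmono : ∀ n, Q n ⊆ Q (n + 1)) (heq : ∀ n, IsEquivRel (Q n)) (hU : (⋃ n, Q n) = E)
    (hcount : ∀ x, {y | (x, y) ∈ E}.Countable)
    (hop : ∀ n, IsOpen {q | (φ q : X × X) ∈ Q n})
    (hcp : ∀ n, IsCompact {q | (φ q : X × X) ∈ Q n}) :
    IsAFEquivRel E (TopologicalSpace.coinduced φ inferInstance) := by
  let := TopologicalSpace.metrizableSpaceMetric X
  let ψ : ∀ n, {q // (φ q : X × X) ∈ Q n} → ↥(Q n) := fun n q => ⟨φ q.1, q.2⟩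
  have hψ : ∀ n, IsHomeomorph (ψ n) := by
    intro n
    have : CompactSpace {q // (φ q : X × X) ∈ Q n} := isCompact_iff_compactSpace.1 (hcp n)
    rw [isHomeomorph_iff_continuous_bijective]
    refine ⟨(hc.comp continuous_subtype_val).subtype_mk _, ?_, ?_⟩
    · rintro ⟨a, ha⟩ ⟨b, hb'⟩ h
      have h' : (φ a : X × X) = φ b := congrArg (fun p : ↥(Q n) => (p : X × X)) h
      exact Subtype.ext (hb.1 (Subtype.ext h'))
    · rintro ⟨p, hp⟩
      obtain ⟨q, hq⟩ := hb.2 ⟨p, hsub n hp⟩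
      have hq' : (φ q : X × X) = p := congrArg Subtype.val hq
      exact ⟨⟨q, by rw [hq']; exact hp⟩, Subtype.ext hq'⟩
  have hcQ : ∀ n, CompactSpace ↥(Q n) := by
    intro n
    have : CompactSpace {q // (φ q : X × X) ∈ Q n} := isCompact_iff_compactSpace.1 (hcp n)
    exact (hψ n).surjective.compactSpace (hψ n).continuous
  refine ⟨Q, hsub, h0, hmono, ?_, ?_, hU, ?_⟩
  · intro n
    have := hcQ n
    refine ⟨⟨(heq n).1, (heq n).2.1, (heq n).2.2, fun x => (hcount x).mono fun y hy => hsub n hy,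
      ?_, ?_, ?_, ?_, ?_, ?_⟩, hcQ n⟩
    · exact inferInstanceAs (T2Space ↥(Q n))
    · exact inferInstanceAs (LocallyCompactSpace ↥(Q n))
    · exact inferInstanceAs (SecondCountableTopology ↥(Q n))
    · unfold compPairsTop relTop compMap
      fun_prop
    · have hinv : Continuous (invMap (Q n) (heq n).2.1) := by
        unfold invMap; fun_prop
      show IsHomeomorph (invMap (Q n) (heq n).2.1)
      rw [isHomeomorph_iff_exists_inverse]
      exact ⟨hinv, invMap (Q n) (heq n).2.1, fun _ => rfl, fun _ => rfl, hinv⟩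
    · show IsLocalHomeomorph (fun p : ↥(Q n) => (p : X × X).1)
      have h1 : IsLocalHomeomorph ((fun p : ↥(Q n) => (p : X × X).1) ∘ ψ n) :=
        hlh.comp (hop n).isOpenEmbedding_subtypeVal.isLocalHomeomorph
      have h2 := h1.comp (hψ n).homeomorph.symm.isLocalHomeomorph
      convert h2 using 1
      ext p
      have := (hψ n).homeomorph.apply_symm_apply p
      exact (congrArg (fun p : ↥(Q n) => (p : X × X).1) this).symm
  · intro n
    show IsOpen ((Subtype.val : ↥(Q (n + 1)) → X × X) ⁻¹' Q n)
    rw [← (hψ (n + 1)).isQuotientMap.isOpen_preimage]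
    exact (hop n).preimage continuous_subtype_val
  · refine TopologicalSpace.ext_iff.2 fun U => ?_
    unfold inductiveLimitTop
    rw [isOpen_iSup_iff, isOpen_coinduced]
    simp only [isOpen_coinduced]
    have key : ∀ n, IsOpen[relTop (Q n)]
        ((fun p : ↥(Q n) => (⟨(p : X × X), hsub n p.2⟩ : ↥E)) ⁻¹' U) ↔
        IsOpen (φ ⁻¹' U ∩ {q | (φ q : X × X) ∈ Q n}) := by
      intro n
      show IsOpen ((fun p : ↥(Q n) => (⟨(p : X × X), hsub n p.2⟩ : ↥E)) ⁻¹' U) ↔ _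
      rw [← (hψ n).isQuotientMap.isOpen_preimage,
        (hop n).isOpenEmbedding_subtypeVal.isOpen_iff_image_isOpen]
      have : Subtype.val '' (ψ n ⁻¹' ((fun p : ↥(Q n) =>
          (⟨(p : X × X), hsub n p.2⟩ : ↥E)) ⁻¹' U)) =
          φ ⁻¹' U ∩ {q | (φ q : X × X) ∈ Q n} := by
        ext q
        constructor
        · rintro ⟨⟨q, hq⟩, h, rfl⟩
          exact ⟨h, hq⟩
        · rintro ⟨h, hq⟩
          exact ⟨⟨q, hq⟩, h, rfl⟩
      exact Iff.of_eq (congrArg IsOpen this)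
    refine Iff.trans ?_ (forall_congr' key).symm
    constructor
    · intro h n
      exact h.inter (hop n)
    · intro h
      have : φ ⁻¹' U = ⋃ n, (φ ⁻¹' U ∩ {q | (φ q : X × X) ∈ Q n}) := by
        rw [← Set.inter_iUnion]
        symm
        rw [Set.inter_eq_left]
        intro q _
        have := hU.symm.subset (φ q).2
        simpa using this
      rw [this]
      exact isOpen_iUnion h

/-- Consequences of being AF. -/
theorem af_facts {X : Type u} [TopologicalSpace X] [T2Space X]
    (R : Set (X × X)) (Rs : ℕ → Set (X × X)) (hsub : ∀ n, Rs n ⊆ R)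
    (h0 : Rs 0 = Set.diagonal X) (hmono : ∀ n, Rs n ⊆ Rs (n + 1))
    (hce : ∀ n, IsCEER (Rs n) (relTop (Rs n)))
    (hop : ∀ n, IsOpen[relTop (Rs (n + 1))]
      ((Subtype.val : ↥(Rs (n + 1)) → X × X) ⁻¹' Rs n))
    (hU : (⋃ n, Rs n) = R) (T : TopologicalSpace ↥R) (hT : T = inductiveLimitTop R Rs hsub) :
    Continuous[T, inferInstance] (Subtype.val : ↥R → X × X) ∧
    @IsLocalHomeomorph ↥R X T inferInstance (fun p => (p : X × X).1) ∧
    (∀ hd : ∀ x, (x, x) ∈ R, Continuous[inferInstance, T] fun x : X => (⟨(x, x), hd x⟩ : ↥R)) ∧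
    (∀ n, IsOpen[T] ((Subtype.val : ↥R → X × X) ⁻¹' Rs n)) ∧
    (∀ n, @IsCompact _ T ((Subtype.val : ↥R → X × X) ⁻¹' Rs n)) := by
  let i : ∀ n, ↥(Rs n) → ↥R := fun n p => ⟨(p : X × X), hsub n p.2⟩
  have hmono' : Monotone Rs := monotone_nat_of_le_succ hmono
  have hic : ∀ n, Continuous[relTop (Rs n), T] (i n) := by
    intro n
    rw [hT, continuous_iff_coinduced_le]
    exact le_iSup (fun n => TopologicalSpace.coinduced (i n) (relTop (Rs n))) n
  have hv : Continuous[T, inferInstance] (Subtype.val : ↥R → X × X) := by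
    rw [hT]
    refine continuous_iSup_dom.2 fun n => continuous_coinduced_dom.2 ?_
    exact continuous_subtype_val
  have hchain : ∀ n k, IsOpen[relTop (Rs (n + k))]
      ((Subtype.val : ↥(Rs (n + k)) → X × X) ⁻¹' Rs n) := by
    intro n k
    induction k with
    | zero =>
      convert @isOpen_univ _ (relTop (Rs (n + 0))) using 1
      ext p
      simp
    | succ k ih =>
      have h1 := hop (n + k)
      obtain ⟨V, hV, hV'⟩ := isOpen_induced_iff.1 ih
      obtain ⟨W, hW, hW'⟩ := isOpen_induced_iff.1 h1
      refine isOpen_induced_iff.2 ⟨V ∩ W, hV.inter hW, ?_⟩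
      ext p
      have e1 : (p : X × X) ∈ W ↔ (p : X × X) ∈ Rs (n + k) := Set.ext_iff.1 hW' p
      constructor
      · rintro ⟨hpV, hpW⟩
        exact (Set.ext_iff.1 hV' ⟨p, e1.1 hpW⟩).1 hpV
      · intro hp
        have hp' : (p : X × X) ∈ Rs (n + k) := hmono' (Nat.le_add_right n k) hp
        exact ⟨(Set.ext_iff.1 hV' ⟨p, hp'⟩).2 hp, e1.2 hp'⟩
  have hopR : ∀ n, IsOpen[T] ((Subtype.val : ↥R → X × X) ⁻¹' Rs n) := by
    intro n
    rw [hT]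
    unfold inductiveLimitTop
    rw [isOpen_iSup_iff]
    intro m
    rw [isOpen_coinduced]
    rcases le_total n m with h | h
    · obtain ⟨k, rfl⟩ := Nat.exists_eq_add_of_le h
      exact hchain n k
    · convert @isOpen_univ _ (relTop (Rs m)) using 1
      ext p
      simpa using hmono' h p.2
  have hrange : ∀ n, Set.range (i n) = (Subtype.val : ↥R → X × X) ⁻¹' Rs n := by
    intro n
    ext p
    constructor
    · rintro ⟨q, rfl⟩
      exact q.2
    · intro hp
      exact ⟨⟨p, hp⟩, rfl⟩
  have hcpR : ∀ n, @IsCompact _ T ((Subtype.val : ↥R → X × X) ⁻¹' Rs n) := by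
    intro n
    rw [← hrange]
    have : @CompactSpace ↥(Rs n) (relTop (Rs n)) := (hce n).2
    exact @isCompact_range _ _ (relTop (Rs n)) T this _ (hic n)
  have hT2 : @T2Space ↥R T := T2Space.of_injective_continuous Subtype.val_injective hv
  refine ⟨hv, ?_, ?_, hopR, hcpR⟩
  · intro p
    obtain ⟨n, hn⟩ := Set.mem_iUnion.1 (hU.symm ▸ p.2 : (p : X × X) ∈ ⋃ n, Rs n)
    have : @CompactSpace ↥(Rs n) (relTop (Rs n)) := (hce n).2
    have hemb : @IsOpenEmbedding _ _ (relTop (Rs n)) T (i n) := by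
      have hcl : @IsClosedEmbedding _ _ (relTop (Rs n)) T (i n) :=
        @Continuous.isClosedEmbedding _ _ (relTop (Rs n)) T this hT2 _ (hic n) fun a b h => Subtype.ext (congrArg (fun q : ↥R => (q : X × X)) h)
      refine @IsOpenEmbedding.mk _ _ (relTop (Rs n)) T _ hcl.isEmbedding ?_
      rw [hrange]
      exact hopR n
    have h1 := (hemb.isLocalHomeomorph).isLocalHomeomorphOn (s := Set.univ)
    have h2 : IsLocalHomeomorph ((fun p : ↥R => (p : X × X).1) ∘ (i n)) :=
      (hce n).1.localHomeo_range
    have h3 := @IsLocalHomeomorphOn.of_comp_right _ _ _ (relTop (Rs n)) T _ _ _ _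
      h2.isLocalHomeomorphOn h1
    exact h3 p ⟨⟨p, hn⟩, trivial, rfl⟩
  · intro hd
    have hd0 : ∀ x : X, (x, x) ∈ Rs 0 := fun x => by rw [h0]; rfl
    have : Continuous fun x : X => (⟨(x, x), hd0 x⟩ : ↥(Rs 0)) := by fun_prop
    exact (hic 0).comp this

theorem ceer_facts {X : Type u} [TopologicalSpace X] [T2Space X]
    (S : Set (X × X)) (T' : TopologicalSpace ↥S) (hS : IsCEER S T') :
    Continuous[T', inferInstance] (Subtype.val : ↥S → X × X) ∧
    IsOpenMap (fun p : ↥S => (p : X × X).2) ∧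
    (∀ hd : ∀ x, (x, x) ∈ S,
      Continuous[inferInstance, T'] fun x : X => (⟨(x, x), hd x⟩ : ↥S)) := by
  obtain ⟨hE, hC⟩ := hS
  have h1 : Continuous (fun p : ↥S => (p : X × X).1) := hE.localHomeo_range.continuous
  have h2 : Continuous (fun p : ↥S => (p : X × X).2) := h1.comp hE.homeo_inv.continuous
  have hv : Continuous[T', inferInstance] (Subtype.val : ↥S → X × X) := h1.prodMk h2
  refine ⟨hv, hE.localHomeo_range.isOpenMap.comp hE.homeo_inv.isOpenMap, ?_⟩
  intro hd
  have hcl := hv.isClosedEmbedding Subtype.val_injective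
  rw [hcl.isInducing.continuous_iff]
  exact continuous_id.prodMk continuous_id

/-- The part of `R` all of whose `S`-translates lie in `Rn`. -/
def coreRel {X : Type u} (R S Rn : Set (X × X)) : Set (X × X) :=
  {p | p ∈ R ∧ ∀ x' y', (x', p.1) ∈ S → (y', p.2) ∈ S → (x', y') ∈ R → (x', y') ∈ Rn}

theorem coreRel_isEquivRel {X : Type u} {R S Rn : Set (X × X)} (hR : IsEquivRel R)
    (hS : IsEquivRel S) (hn : IsEquivRel Rn) (hd : R ∩ S = Set.diagonal X)
    (hcomm : ∀ a b c, (a, b) ∈ S → (b, c) ∈ R → ∃ d, (a, d) ∈ R ∧ (d, c) ∈ S) :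
    IsEquivRel (coreRel R S Rn) := by
  refine ⟨fun x => ⟨hR.1 x, ?_⟩, fun x y h => ⟨hR.2.1 h.1, ?_⟩, fun x y z h1 h2 =>
    ⟨hR.2.2 h1.1 h2.1, ?_⟩⟩
  · intro x' y' h1 h2 h3
    have : (x', y') ∈ R ∩ S := ⟨h3, hS.2.2 h1 (hS.2.1 h2)⟩
    rw [hd] at this
    have : x' = y' := this
    subst this
    exact hn.1 x'
  · intro x' y' h1 h2 h3
    exact hn.2.1 (h.2 _ _ h2 h1 (hR.2.1 h3))
  · intro x' z' hx hz hxz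
    obtain ⟨y', hy1, hy2⟩ := hcomm x' x y hx h1.1
    exact hn.2.2 (h1.2 _ _ hx hy2 hy1) (h2.2 _ _ hy2 hz (hR.2.2 (hR.2.1 hy1) hxz))

theorem coreRel_comm {X : Type u} {R S Rn : Set (X × X)}
    (hS : IsEquivRel S)
    (hcomm : ∀ a b c, (a, b) ∈ S → (b, c) ∈ R → ∃ d, (a, d) ∈ R ∧ (d, c) ∈ S)
    (a b c : X) (h1 : (a, b) ∈ S) (h2 : (b, c) ∈ coreRel R S Rn) :
    ∃ d, (a, d) ∈ coreRel R S Rn ∧ (d, c) ∈ S := by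
  obtain ⟨d, hd1, hd2⟩ := hcomm a b c h1 h2.1
  refine ⟨d, ⟨hd1, fun x' y' hx hy hxy => ?_⟩, hd2⟩
  exact h2.2 x' y' (hS.2.2 hx h1) (hS.2.2 hy hd2) hxy

theorem setComp_isEquivRel {X : Type u} {R S : Set (X × X)} (hR : IsEquivRel R)
    (hS : IsEquivRel S)
    (hcomm : ∀ a b c, (a, b) ∈ S → (b, c) ∈ R → ∃ d, (a, d) ∈ R ∧ (d, c) ∈ S) :
    IsEquivRel (SetComp R S) := by
  refine ⟨fun x => ⟨x, hR.1 x, hS.1 x⟩, ?_, ?_⟩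
  · rintro x y ⟨w, h1, h2⟩
    exact hcomm y w x (hS.2.1 h2) (hR.2.1 h1)
  · rintro x y z ⟨w, h1, h2⟩ ⟨v, h3, h4⟩
    obtain ⟨d, hd1, hd2⟩ := hcomm w y v h2 h3
    exact ⟨d, hR.2.2 h1 hd1, hS.2.2 hd2 h4⟩

theorem joinRel_eq {X : Type u} {R S : Set (X × X)} (hR : IsEquivRel R)
    (hS : IsEquivRel S)
    (hcomm : ∀ a b c, (a, b) ∈ S → (b, c) ∈ R → ∃ d, (a, d) ∈ R ∧ (d, c) ∈ S) :
    joinRel R S = SetComp R S := by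
  have hE := setComp_isEquivRel hR hS hcomm
  ext ⟨x, z⟩
  constructor
  · intro h
    have h' : Relation.EqvGen (fun a b => (a, b) ∈ R ∨ (a, b) ∈ S) x z := h
    clear h
    induction h' with
    | rel a b h =>
      rcases h with h | h
      · exact ⟨b, h, hS.1 b⟩
      · exact ⟨a, hR.1 a, h⟩
    | refl a => exact hE.1 a
    | symm a b _ ih => exact hE.2.1 ih
    | trans a b c _ _ ih1 ih2 => exact hE.2.2 ih1 ih2
  · rintro ⟨y, h1, h2⟩
    exact Relation.EqvGen.trans _ _ _ (Relation.EqvGen.rel _ _ (Or.inl h1))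
      (Relation.EqvGen.rel _ _ (Or.inr h2))

theorem core_top {X : Type u} [TopologicalSpace X] [T2Space X]
    (R : Set (X × X)) (T : TopologicalSpace ↥R)
    (S : Set (X × X)) (T' : TopologicalSpace ↥S) (hSc : CompactSpace ↥S)
    (hRE : IsEquivRel R) (hSE : IsEquivRel S)
    (hRv : Continuous[T, inferInstance] (Subtype.val : ↥R → X × X))
    (hSv : Continuous[T', inferInstance] (Subtype.val : ↥S → X × X))
    (hSo : IsOpenMap (fun p : ↥S => (p : X × X).2))
    (hd : R ∩ S = Set.diagonal X)
    (g : Fib S R → Fib R S) (hg : Continuous[fibTop T' T, fibTop T T'] g)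
    (hgR : ∀ q, fibR (g q) = fibR q) (hgS : ∀ q, fibS (g q) = fibS q)
    (Rs : ℕ → Set (X × X)) (hmono : Monotone Rs) (hU : (⋃ n, Rs n) = R)
    (hop : ∀ n, IsOpen[T] ((Subtype.val : ↥R → X × X) ⁻¹' Rs n))
    (hcp : ∀ n, IsCompact ((Subtype.val : ↥R → X × X) ⁻¹' Rs n)) :
    (∀ n, IsOpen[T] ((Subtype.val : ↥R → X × X) ⁻¹' coreRel R S (Rs n))) ∧
    (∀ n, IsCompact ((Subtype.val : ↥R → X × X) ⁻¹' coreRel R S (Rs n))) ∧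
    (⋃ n, coreRel R S (Rs n)) = R := by
  have hT2 : T2Space ↥R := T2Space.of_injective_continuous Subtype.val_injective hRv
  have hR1 : Continuous (fun p : ↥R => (p : X × X).1) := continuous_fst.comp hRv
  have hS2 : Continuous (fun p : ↥S => (p : X × X).2) := continuous_snd.comp hSv
  let P : Fib S R → ↥R := fun q => q.1.2
  let τ : Fib S R → ↥R := fun q => (g q).1.1
  have hτ : Continuous τ := (continuous_fst.comp continuous_subtype_val).comp hg
  have hPo : IsOpenMap P := pb_snd_open hSo hR1
  have hPp : IsProperMap P :=
    isProperMap_snd_of_compactSpace.comp (pb_closedEmb hS2 hR1).isProperMap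
  have hcl : ∀ n, IsClosed ((Subtype.val : ↥R → X × X) ⁻¹' Rs n) := fun n => (hcp n).isClosed
  -- description of the core
  have hcore : ∀ n, ∀ p : ↥R, (p : X × X) ∈ coreRel R S (Rs n) ↔
      ∀ q, P q = p → (τ q : X × X) ∈ Rs n := by
    rintro n ⟨⟨x, y⟩, hp⟩
    constructor
    · rintro ⟨_, h⟩ q hq
      have e1 : (q.1.2 : X × X) = (x, y) := congrArg Subtype.val hq
      have e2 : (q.1.1 : X × X).2 = x := by rw [q.2, e1]
      have e3 : ((g q).1.1 : X × X).1 = (q.1.1 : X × X).1 := hgR q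
      have e4 : ((g q).1.2 : X × X).2 = y := by
        have : ((g q).1.2 : X × X).2 = (q.1.2 : X × X).2 := hgS q
        rw [this, e1]
      refine h _ _ ?_ ?_ (g q).1.1.2
      · have := q.1.1.2
        rw [e3]
        convert this using 1
        exact Prod.ext rfl e2.symm
      · rw [(g q).2]
        convert (g q).1.2.2 using 1
        exact Prod.ext rfl e4.symm
    · intro h
      refine ⟨hp, fun x' y' hx hy hxy => ?_⟩
      have h' := h ⟨(⟨(x', x), hx⟩, ⟨(x, y), hp⟩), rfl⟩ rfl
      have e3 := hgR ⟨(⟨(x', x), hx⟩, ⟨(x, y), hp⟩), rfl⟩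
      have e4 := hgS ⟨(⟨(x', x), hx⟩, ⟨(x, y), hp⟩), rfl⟩
      simp only [τ] at h'
      generalize g ⟨(⟨(x', x), hx⟩, ⟨(x, y), hp⟩), rfl⟩ = w at h' e3 e4
      obtain ⟨⟨⟨⟨a, b⟩, hab⟩, ⟨⟨b', c⟩, hbc⟩⟩, hbb⟩ := w
      simp only [fibR, fibS] at hbb e3 e4 h'
      subst hbb e3 e4
      have : (b, y') ∈ R ∩ S := ⟨hRE.2.2 (hRE.2.1 hab) hxy, hSE.2.2 hbc (hSE.2.1 hy)⟩
      rw [hd] at this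
      have : b = y' := this
      subst this
      exact h'
  have hset : ∀ n, (Subtype.val : ↥R → X × X) ⁻¹' coreRel R S (Rs n) =
      (P '' (τ ⁻¹' ((Subtype.val : ↥R → X × X) ⁻¹' Rs n))ᶜ)ᶜ := by
    intro n
    ext p
    rw [Set.mem_preimage, hcore]
    simp only [Set.mem_compl_iff, Set.mem_image, Set.mem_preimage, not_exists, not_and]
    exact ⟨fun h q hq1 hq2 => hq1 (h q hq2), fun h q hq => by_contra fun h' => h q h' hq⟩
  have hsubn : ∀ n, (Subtype.val : ↥R → X × X) ⁻¹' coreRel R S (Rs n) ⊆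
      (Subtype.val : ↥R → X × X) ⁻¹' Rs n := by
    rintro n ⟨⟨x, y⟩, hp⟩ h
    exact h.2 x y (hSE.1 x) (hSE.1 y) hp
  refine ⟨fun n => ?_, fun n => ?_, ?_⟩
  · rw [hset]
    exact (hPp.isClosedMap _ ((hop n).preimage hτ).isClosed_compl).isOpen_compl
  · refine (hcp n).of_isClosed_subset ?_ (hsubn n)
    rw [hset]
    exact (hPo _ ((hcl n).preimage hτ).isOpen_compl).isClosed_compl
  · refine Set.Subset.antisymm (Set.iUnion_subset fun n p hp => hp.1) ?_
    intro p hp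
    have hK : IsCompact (P ⁻¹' {⟨p, hp⟩}) := hPp.isCompact_preimage isCompact_singleton
    obtain ⟨n, hn⟩ := hK.elim_directed_cover
      (fun n => τ ⁻¹' ((Subtype.val : ↥R → X × X) ⁻¹' Rs n)) (fun n => (hop n).preimage hτ)
      (fun q _ => by
        have := hU.symm.subset (τ q).2
        simpa using this)
      (directed_of_isDirected_le fun a b hab q hq => hmono hab hq)
    exact Set.mem_iUnion.2 ⟨n, (hcore n ⟨p, hp⟩).2 fun q hq => hn hq⟩


/-- If `(R, T)` is an AF-equivalence relation and `S` is a CEER on `X`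
transverse to `R`, then `R ∨ S`, with the étale topology transferred from `R ×_X S` via
`r × s`, is an AF-equivalence relation on `X`. -/
theorem join_af_ceer_is_af {X : Type} [TopologicalSpace X] [CompactSpace X]
    [TopologicalSpace.MetrizableSpace X] [TotallyDisconnectedSpace X]
    (R : Set (X × X)) (T : TopologicalSpace ↥R) (hR : IsAFEquivRel R T)
    (S : Set (X × X)) (T' : TopologicalSpace ↥S) (hS : IsCEER S T')
    (htr : AreTransverse R T S T') :
    IsAFEquivRel (joinRel R S) (joinTop R S T T') := by
  obtain ⟨Rs, hsub, h0, hmono, hce, hopn, hU, hT⟩ := hR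
  obtain ⟨hd, h, hh, hhR, hhS⟩ := htr
  obtain ⟨hRv, hRl, hRd, hRo, hRc⟩ := af_facts R Rs hsub h0 hmono hce hopn hU T hT
  obtain ⟨hSv, hSo, hSd⟩ := ceer_facts S T' hS
  have hSc : CompactSpace ↥S := hS.2
  have hm : Monotone Rs := monotone_nat_of_le_succ hmono
  have hSE : IsEquivRel S := ⟨hS.1.refl, hS.1.symm, hS.1.trans⟩
  have hnE : ∀ n, IsEquivRel (Rs n) := fun n => ⟨(hce n).1.refl, (hce n).1.symm, (hce n).1.trans⟩
  have hRmem : ∀ p, p ∈ R ↔ ∃ n, p ∈ Rs n := fun p => by rw [← hU]; simp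
  have hRE : IsEquivRel R := by
    refine ⟨fun x => hsub 0 ((hnE 0).1 x), fun x y hxy => ?_, fun x y z hxy hyz => ?_⟩
    · obtain ⟨n, hn⟩ := (hRmem _).1 hxy
      exact hsub n ((hnE n).2.1 hn)
    · obtain ⟨n, hn⟩ := (hRmem _).1 hxy
      obtain ⟨m, hm'⟩ := (hRmem _).1 hyz
      exact hsub (max n m) ((hnE _).2.2 (hm (le_max_left n m) hn) (hm (le_max_right n m) hm'))
  obtain ⟨g, hgl, hgr⟩ := Function.bijective_iff_has_inverse.1 hh.bijective
  have hg : Continuous[fibTop T' T, fibTop T T'] g := by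
    refine @Continuous.mk _ _ (fibTop T' T) (fibTop T T') _ fun U hU' => ?_
    have : g ⁻¹' U = h '' U := by
      rw [Set.image_eq_preimage_of_inverse hgl hgr]
    rw [this]
    exact hh.isOpenMap U hU'
  have hgR : ∀ q, fibR (g q) = fibR q := fun q => by rw [← hhR, hgr]
  have hgS : ∀ q, fibS (g q) = fibS q := fun q => by rw [← hhS, hgr]
  have hcomm : ∀ a b c, (a, b) ∈ S → (b, c) ∈ R → ∃ d, (a, d) ∈ R ∧ (d, c) ∈ S := by
    intro a b c hab hbc
    have e3 := hgR ⟨(⟨(a, b), hab⟩, ⟨(b, c), hbc⟩), rfl⟩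
    have e4 := hgS ⟨(⟨(a, b), hab⟩, ⟨(b, c), hbc⟩), rfl⟩
    generalize g ⟨(⟨(a, b), hab⟩, ⟨(b, c), hbc⟩), rfl⟩ = w at e3 e4
    obtain ⟨⟨⟨⟨a', d⟩, had⟩, ⟨⟨d', c'⟩, hdc⟩⟩, hdd⟩ := w
    simp only [fibR, fibS] at hdd e3 e4
    subst hdd e3 e4
    exact ⟨d, had, hdc⟩
  obtain ⟨hCo, hCc, hCU⟩ := core_top R T S T' hSc hRE hSE hRv hSv hSo hd g hg hgR hgS Rs hm hU
    hRo hRc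
  have hj := joinRel_eq hRE hSE hcomm
  have hCE : ∀ n, IsEquivRel (coreRel R S (Rs n)) := fun n =>
    coreRel_isEquivRel hRE hSE (hnE n) hd hcomm
  have hRs : Continuous (fun p : ↥R => (p : X × X).2) := continuous_snd.comp hRv
  have hSr : Continuous (fun p : ↥S => (p : X × X).1) := continuous_fst.comp hSv
  let instF : TopologicalSpace (Fib R S) := fibTop T T'
  have hemb : IsClosedEmbedding (Subtype.val : Fib R S → ↥R × ↥S) := pb_closedEmb hRs hSr
  have c1 : Continuous (fun q : Fib R S => q.1.1) := continuous_fst.comp hemb.continuous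
  have c2 : Continuous (fun q : Fib R S => q.1.2) := continuous_snd.comp hemb.continuous
  have hlh : IsLocalHomeomorph (fun q : Fib R S => (q.1.1 : X × X).1) :=
    hRl.comp (pb_fst_lh hRs hS.1.localHomeo_range)
  have hdiagc : Continuous (fun x : X =>
      (⟨(⟨(x, x), hRE.1 x⟩, ⟨(x, x), hSE.1 x⟩), rfl⟩ : Fib R S)) := by
    rw [hemb.isInducing.continuous_iff]
    exact (hRd hRE.1).prodMk (hSd hSE.1)
  have hinj : ∀ x y y' z, (x, y) ∈ R → (x, y') ∈ R → (y, z) ∈ S → (y', z) ∈ S → y = y' := by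
    intro x y y' z h1 h2 h3 h4
    have : (y, y') ∈ R ∩ S := ⟨hRE.2.2 (hRE.2.1 h1) h2, hSE.2.2 h3 (hSE.2.1 h4)⟩
    rw [hd] at this
    exact this
  let Q : ℕ → Set (X × X) := fun n =>
    Nat.casesOn n (Set.diagonal X) fun n => SetComp (coreRel R S (Rs n)) S
  have hQ0 : {q : Fib R S | (rsFun R S q : X × X) ∈ Q 0} = Set.range (fun x : X =>
      (⟨(⟨(x, x), hRE.1 x⟩, ⟨(x, x), hSE.1 x⟩), rfl⟩ : Fib R S)) := by
    ext q
    constructor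
    · intro hq
      obtain ⟨⟨⟨⟨x, y⟩, hxy⟩, ⟨⟨y', z⟩, hyz⟩⟩, hyy⟩ := q
      have hq' : x = z := hq
      simp only at hyy
      subst hyy hq'
      have := hinj x y x x hxy (hRE.1 x) hyz (hSE.1 x)
      subst this
      exact ⟨y, rfl⟩
    · rintro ⟨x, rfl⟩
      exact rfl
  have hQs : ∀ n, {q : Fib R S | (rsFun R S q : X × X) ∈ Q (n + 1)} =
      (fun q : Fib R S => q.1.1) ⁻¹' ((Subtype.val : ↥R → X × X) ⁻¹' coreRel R S (Rs n)) := by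
    intro n
    ext q
    obtain ⟨⟨⟨⟨x, y⟩, hxy⟩, ⟨⟨y', z⟩, hyz⟩⟩, hyy⟩ := q
    simp only at hyy
    subst hyy
    constructor
    · rintro ⟨w, h1, h2⟩
      have := hinj x y w z hxy h1.1 hyz h2
      subst this
      exact h1
    · intro hq
      exact ⟨y, hq, hyz⟩
  refine af_of_data (joinRel R S) (rsFun R S) ⟨?_, ?_⟩ ?_ hlh Q ?_ rfl ?_ ?_ ?_ ?_ ?_ ?_
  · rintro ⟨⟨⟨⟨x, y⟩, hxy⟩, ⟨⟨y', z⟩, hyz⟩⟩, hyy⟩ ⟨⟨⟨⟨a, b⟩, hab⟩, ⟨⟨b', c⟩, hbc⟩⟩, hbb⟩ he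
    have he' : (x, z) = (a, c) := congrArg Subtype.val he
    simp only [Prod.mk.injEq] at he' hyy hbb
    obtain ⟨e1, e2⟩ := he'
    subst hyy hbb e1 e2
    have := hinj x y b z hxy hab hyz hbc
    subst this
    rfl
  · rintro ⟨⟨x, z⟩, hp⟩
    obtain ⟨y, h1, h2⟩ := hj.subset hp
    exact ⟨⟨(⟨(x, y), h1⟩, ⟨(y, z), h2⟩), rfl⟩, rfl⟩
  · exact ((continuous_fst.comp hRv).comp c1).prodMk ((continuous_snd.comp hSv).comp c2)
  · rintro (_ | n) ⟨x, z⟩ hp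
    · rw [hj]
      have hp' : x = z := hp
      subst hp'
      exact ⟨x, hRE.1 x, hSE.1 x⟩
    · rw [hj]
      obtain ⟨y, h1, h2⟩ := hp
      exact ⟨y, h1.1, h2⟩
  · rintro (_ | n) ⟨x, z⟩ hp
    · have hp' : x = z := hp
      subst hp'
      exact ⟨x, (hCE 0).1 x, hSE.1 x⟩
    · obtain ⟨y, h1, h2⟩ := hp
      exact ⟨y, ⟨h1.1, fun x' y' a b c => hmono n (h1.2 x' y' a b c)⟩, h2⟩
  · rintro (_ | n)
    · exact ⟨fun x => rfl, fun x y hxy => Eq.symm hxy, fun x y z hxy hyz => Eq.trans hxy hyz⟩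
    · exact setComp_isEquivRel (hCE n) hSE (coreRel_comm hSE hcomm)
  · rw [hj]
    ext ⟨x, z⟩
    rw [Set.mem_iUnion]
    constructor
    · rintro ⟨_ | n, hp⟩
      · have hp' : x = z := hp
        subst hp'
        exact ⟨x, hRE.1 x, hSE.1 x⟩
      · obtain ⟨y, h1, h2⟩ := hp
        exact ⟨y, h1.1, h2⟩
    · rintro ⟨y, h1, h2⟩
      obtain ⟨n, hn⟩ := Set.mem_iUnion.1 (hCU.symm.subset h1)
      exact ⟨n + 1, y, hn, h2⟩
  · intro x
    have : {z | (x, z) ∈ joinRel R S} ⊆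
        ⋃ n, ⋃ y ∈ {y | (x, y) ∈ Rs n}, {z | (y, z) ∈ S} := by
      intro z hz
      obtain ⟨y, h1, h2⟩ := hj.subset hz
      obtain ⟨n, hn⟩ := (hRmem _).1 h1
      exact Set.mem_iUnion.2 ⟨n, Set.mem_biUnion (x := y) hn h2⟩
    refine Set.Countable.mono this (Set.countable_iUnion fun n => ?_)
    exact ((hce n).1.countable x).biUnion fun y _ => hS.1.countable y
  · rintro (_ | n)
    · rw [hQ0]
      exact (IsLocalHomeomorph.isOpenEmbedding_of_comp
        (f := fun x : X => (⟨(⟨(x, x), hRE.1 x⟩, ⟨(x, x), hSE.1 x⟩), rfl⟩ : Fib R S))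
        hlh IsOpenEmbedding.id hdiagc).isOpen_range
    · rw [hQs]
      exact (hCo n).preimage c1
  · rintro (_ | n)
    · rw [hQ0]
      exact isCompact_range hdiagc
    · rw [hQs]
      have : (fun q : Fib R S => q.1.1) ⁻¹' ((Subtype.val : ↥R → X × X) ⁻¹' coreRel R S (Rs n)) =
          Subtype.val ⁻¹' (((Subtype.val : ↥R → X × X) ⁻¹' coreRel R S (Rs n)) ×ˢ
            (Set.univ : Set ↥S)) := by
        ext q
        simp
      rw [this]
      exact hemb.isCompact_preimage ((hCc n).prod isCompact_univ)
end
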